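/- For every even integer k ≥ 2, every integer m > k, and every real number q with 0 < q < 1, the Condorcet least-reversal rule satisfies the (q,k,m)-majority criterion if and only if q ≥ (5k−2)/(8k). -/

import Mathlib

open Finset
open scoped Classical

noncomputable section

/-- A preference profile: each of the `n` voters has a ranking of the `m`
candidates, given as a bijection sending each candidate to its rank
(rank `0` is the best).  Voter `i` prefers `a` to `b` iff `P i a < P i b`. -/
abbrev Profile (m n : ℕ) := Fin n → (Fin m ≃ Fin m)

namespace Voting

variable {m n : ℕ}

/-- `h(a,b)`: the number of voters who prefer candidate `a` to candidate `b`. -/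
def pairs (P : Profile m n) (a b : Fin m) : ℕ :=
  (Finset.univ.filter fun i => P i a < P i b).card

/-- `n_1(a)`: the number of voters who rank candidate `a` first. -/
def firstCount (P : Profile m n) (a : Fin m) : ℕ :=
  (Finset.univ.filter fun i => ∀ b, b ≠ a → P i a < P i b).card

/-- `n_m(a)`: the number of voters who rank candidate `a` last. -/
def lastCount (P : Profile m n) (a : Fin m) : ℕ :=
  (Finset.univ.filter fun i => ∀ b, b ≠ a → P i b < P i a).card

/-- The number of voters who give the set `B` the top `|B|` positions. -/
def topSupporters (P : Profile m n) (B : Finset (Fin m)) : ℕ :=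
  (Finset.univ.filter fun i => ∀ a ∈ B, ∀ b ∉ B, P i a < P i b).card

/-- The `(q,k,m)`-majority criterion for a voting rule with `m` candidates:
for every number of voters `n ≥ 1`, every profile, and every `k`-element set `B`
of candidates such that strictly more than `q·n` voters give `B` the top `k`
positions, every winner belongs to `B`. -/
def MajorityCriterion (m k : ℕ) (q : ℝ)
    (rule : (n : ℕ) → Profile m n → Finset (Fin m)) : Prop :=
  ∀ n : ℕ, 1 ≤ n → ∀ P : Profile m n, ∀ B : Finset (Fin m),
    B.card = k → q * (n : ℝ) < (topSupporters P B : ℝ) → rule n P ⊆ B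

/-- The Condorcet least-reversal score `p(d) = Σ_{c ≠ d} max{n/2 − h(d,c), 0}`. -/
def clrScore (P : Profile m n) (d : Fin m) : ℝ :=
  ∑ c ∈ Finset.univ.erase d, max ((n : ℝ) / 2 - (pairs P d c : ℝ)) 0

/-- The Condorcet least-reversal rule: winners have the lowest score `p`. -/
def clrWinners (P : Profile m n) : Finset (Fin m) :=
  Finset.univ.filter fun d => ∀ c, clrScore P d ≤ clrScore P c

lemma sum_range_max_two_mul_sub (l : ℕ) :
    ∑ y ∈ range (2 * l), max (2 * (y : ℝ) - 2 * l) 0 = l * (l - 1) := by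
  have h_gauss : ∀ r : ℕ, ∑ y ∈ range r, 2 * (y : ℝ) = r * (r - 1) := by
    intro r
    induction r with
    | zero => simp
    | succ r ih => rw [sum_range_succ, ih]; push_cast; ring
  rw [two_mul, sum_range_add, ← h_gauss l]
  have h_zero : ∑ y ∈ range l, max (2 * (y : ℝ) - 2 * l) 0 = 0 := by
    refine sum_eq_zero fun y hy => max_eq_right ?_
    have : (y : ℝ) < l := by exact_mod_cast mem_range.1 hy
    linarith
  rw [h_zero, zero_add]
  refine sum_congr rfl fun y _ => ?_
  push_cast
  rw [max_eq_left] <;> ring_nf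
  positivity

/-- The cyclic distances from `b` of the elements of `S` are distinct elements of `{1, …, 2l - 1}`,
which bounds the net number of elements of `S` ranked above `b` by its Borda differences. -/
lemma sum_net_above_le {α : Type*} {B S : Finset α} {x : α → ℕ} {l : ℕ} {b : α}
    (hx : Set.InjOn x B) (hlt : ∀ c ∈ B, x c < 2 * l) (hb : b ∈ B) (hS : S ⊆ B)
    (hbS : b ∉ S) :
    4 * l * ∑ c ∈ S, ((1 : ℝ) / 2 - if x b < x c then 1 else 0) ≤
      2 * ∑ c ∈ S, ((x b : ℝ) - x c) + l * (l - 1) := by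
  set y : α → ℕ := fun c => if x b < x c then x c - x b else 2 * l + x c - x b with hy
  have h_ne : ∀ c ∈ S, x c ≠ x b := fun c hc h => hbS (hx (hS hc) hb h ▸ hc)
  have hbl := hlt b hb
  have h_inj : Set.InjOn y S := by
    intro c hc d hd h
    refine hx (hS hc) (hS hd) ?_
    have h1 := hlt c (hS hc)
    have h2 := hlt d (hS hd)
    simp only [hy] at h
    split_ifs at h <;> omega
  have h_bound : ∑ c ∈ S, (2 * (y c : ℝ) - 2 * l) ≤ l * (l - 1) := by
    rw [← sum_range_max_two_mul_sub l]
    calc ∑ c ∈ S, (2 * (y c : ℝ) - 2 * l)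
        ≤ ∑ c ∈ S, max (2 * (y c : ℝ) - 2 * l) 0 := sum_le_sum fun c _ => le_max_left _ _
      _ = ∑ j ∈ S.image y, max (2 * (j : ℝ) - 2 * l) 0 :=
          (sum_image (f := fun j : ℕ => max (2 * (j : ℝ) - 2 * l) 0) h_inj).symm
      _ ≤ _ := by
          refine sum_le_sum_of_subset_of_nonneg ?_ fun _ _ _ => le_max_right _ _
          intro j hj
          obtain ⟨c, hc, rfl⟩ := mem_image.1 hj
          have h1 := hlt c (hS hc)
          have h2 := h_ne c hc
          simp only [hy, mem_range]
          split_ifs <;> omega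
  have h_eq : 4 * l * ∑ c ∈ S, ((1 : ℝ) / 2 - if x b < x c then 1 else 0) =
      2 * ∑ c ∈ S, ((x b : ℝ) - x c) + ∑ c ∈ S, (2 * (y c : ℝ) - 2 * l) := by
    rw [mul_sum, mul_sum, ← sum_add_distrib]
    refine sum_congr rfl fun c hc => ?_
    simp only [hy]
    split_ifs with h
    · rw [Nat.cast_sub h.le]; ring
    · rw [Nat.cast_sub (by omega)]; push_cast; ring
  linarith

/-- The number of candidates of `B` that voter `i` prefers to `c`. -/
def rankIn (P : Profile m n) (B : Finset (Fin m)) (i : Fin n) (c : Fin m) : ℕ :=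
  (B.filter fun a => P i a < P i c).card

lemma rankIn_lt_iff (P : Profile m n) {B : Finset (Fin m)} (i : Fin n) {b c : Fin m}
    (hb : b ∈ B) : rankIn P B i b < rankIn P B i c ↔ P i b < P i c := by
  constructor
  · intro h
    by_contra! hcb
    refine h.not_ge (card_le_card fun a ha => ?_)
    rw [mem_filter] at ha ⊢
    exact ⟨ha.1, ha.2.trans_le hcb⟩
  · intro h
    refine card_lt_card ⟨fun a ha => ?_, fun hsub => ?_⟩
    · rw [mem_filter] at ha ⊢
      exact ⟨ha.1, ha.2.trans h⟩
    · exact lt_irrefl _ (mem_filter.1 (hsub (mem_filter.2 ⟨hb, h⟩))).2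

lemma rankIn_injOn (P : Profile m n) (B : Finset (Fin m)) (i : Fin n) :
    Set.InjOn (rankIn P B i) B := by
  intro b hb c hc h
  apply (P i).injective
  apply le_antisymm <;> rw [← not_lt]
  · rw [← rankIn_lt_iff P i hc, h]; exact lt_irrefl _
  · rw [← rankIn_lt_iff P i hb, h]; exact lt_irrefl _

lemma rankIn_lt_card (P : Profile m n) {B : Finset (Fin m)} (i : Fin n) {c : Fin m}
    (hc : c ∈ B) : rankIn P B i c < B.card :=
  card_lt_card ⟨filter_subset _ _, fun h => lt_irrefl _ (mem_filter.1 (h hc)).2⟩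

lemma half_sub_pairs (P : Profile m n) (b c : Fin m) :
    (n : ℝ) / 2 - pairs P b c = ∑ i, ((1 : ℝ) / 2 - if P i b < P i c then 1 else 0) := by
  rw [sum_sub_distrib, pairs, sum_boole]
  simp [div_eq_mul_inv]

/-- A Borda winner of the profile restricted to `B` has a low least-reversal score inside `B`. -/
lemma exists_sum_max_le (P : Profile m n) {B : Finset (Fin m)} {l : ℕ} (hl : 0 < l)
    (hB : B.card = 2 * l) :
    ∃ b ∈ B, ∑ c ∈ B.erase b, max ((n : ℝ) / 2 - pairs P b c) 0 ≤ n * (l - 1) / 4 := by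
  obtain ⟨b, hb, hmin⟩ := exists_min_image B (fun c => ∑ i, (rankIn P B i c : ℝ))
    (card_pos.1 (by omega))
  refine ⟨b, hb, ?_⟩
  set S := (B.erase b).filter fun c => 0 ≤ (n : ℝ) / 2 - pairs P b c with hS
  have hSB : S ⊆ B := (filter_subset _ _).trans (erase_subset _ _)
  have hbS : b ∉ S := by simp [hS]
  have h_sum : ∑ c ∈ B.erase b, max ((n : ℝ) / 2 - pairs P b c) 0 =
      ∑ c ∈ S, ((n : ℝ) / 2 - pairs P b c) := by
    rw [hS, sum_filter]
    refine sum_congr rfl fun c _ => ?_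
    split_ifs with h
    · exact max_eq_left h
    · exact max_eq_right (not_le.1 h).le
  have h_borda : ∑ i, ∑ c ∈ S, ((rankIn P B i b : ℝ) - rankIn P B i c) ≤ 0 := by
    rw [sum_comm]
    refine sum_nonpos fun c hc => ?_
    rw [sum_sub_distrib]
    exact sub_nonpos.2 (hmin c (hSB hc))
  have h_voters : 4 * l * ∑ c ∈ S, ((n : ℝ) / 2 - pairs P b c) ≤
      ∑ i : Fin n, (2 * ∑ c ∈ S, ((rankIn P B i b : ℝ) - rankIn P B i c) + l * (l - 1)) := by
    simp_rw [half_sub_pairs]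
    rw [sum_comm, mul_sum]
    refine sum_le_sum fun i _ => ?_
    have h := sum_net_above_le (rankIn_injOn P B i)
      (fun c hc => hB ▸ rankIn_lt_card P i hc) hb hSB hbS
    simpa only [rankIn_lt_iff P i hb] using h
  rw [sum_add_distrib, ← mul_sum, sum_const, card_univ, Fintype.card_fin, nsmul_eq_mul] at h_voters
  have hl' : (0 : ℝ) < l := by exact_mod_cast hl
  rw [h_sum]
  refine le_of_mul_le_mul_left ?_ (by positivity : (0 : ℝ) < 4 * l)
  linarith

lemma topSupporters_le_pairs (P : Profile m n) {B : Finset (Fin m)} {a b : Fin m}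
    (ha : a ∈ B) (hb : b ∉ B) : topSupporters P B ≤ pairs P a b :=
  card_le_card fun _ hi => mem_filter.2 ⟨mem_univ _, (mem_filter.1 hi).2 a ha b hb⟩

lemma pairs_add_pairs (P : Profile m n) {a b : Fin m} (hab : a ≠ b) :
    pairs P a b + pairs P b a = n := by
  have h : (univ.filter fun i => P i b < P i a) = univ.filter fun i => ¬ P i a < P i b := by
    refine filter_congr fun i _ => ?_
    have := (P i).injective.ne hab
    rw [not_lt]
    exact ⟨le_of_lt, fun h => lt_of_le_of_ne h this.symm⟩
  rw [pairs, pairs, h, card_filter_add_card_filter_not, card_univ, Fintype.card_fin]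

lemma majorityCriterion_clrWinners {l : ℕ} (hl : 0 < l) {q : ℝ}
    (hq : (5 * (2 * l : ℝ) - 2) / (8 * (2 * l)) ≤ q) :
    MajorityCriterion m (2 * l) q (fun _ P => clrWinners P) := by
  intro n hn P B hB htop d hd
  by_contra hdB
  have hl' : (1 : ℝ) ≤ l := by exact_mod_cast hl
  have hn' : (1 : ℝ) ≤ n := by exact_mod_cast hn
  obtain ⟨b, hb, hscore⟩ := exists_sum_max_le P hl hB
  have hle : clrScore P d ≤ clrScore P b := (mem_filter.1 hd).2 b
  rw [div_le_iff₀ (by positivity)] at hq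
  have hq_half : 1 / 2 ≤ q := by nlinarith
  have h_b : clrScore P b = ∑ c ∈ B.erase b, max ((n : ℝ) / 2 - pairs P b c) 0 := by
    symm
    refine sum_subset (erase_subset_erase _ (subset_univ _)) fun c hc hcB => max_eq_right ?_
    have hcB' : c ∉ B := fun h => hcB (mem_erase.2 ⟨ne_of_mem_erase hc, h⟩)
    have : (topSupporters P B : ℝ) ≤ pairs P b c := by
      exact_mod_cast topSupporters_le_pairs P hb hcB'
    nlinarith
  have h_d : 2 * l * ((topSupporters P B : ℝ) - n / 2) ≤ clrScore P d := by
    calc 2 * l * ((topSupporters P B : ℝ) - n / 2)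
        = ∑ _c ∈ B, ((topSupporters P B : ℝ) - n / 2) := by
          rw [sum_const, hB, nsmul_eq_mul]; push_cast; ring
      _ ≤ ∑ c ∈ B, max ((n : ℝ) / 2 - pairs P d c) 0 := by
          refine sum_le_sum fun c hc => le_max_of_le_left ?_
          have h1 : (topSupporters P B : ℝ) ≤ pairs P c d := by
            exact_mod_cast topSupporters_le_pairs P hc hdB
          have h2 : (pairs P c d : ℝ) + pairs P d c = n := by
            exact_mod_cast pairs_add_pairs P (a := c) (b := d) (fun h => hdB (h ▸ hc))
          linarith
      _ ≤ clrScore P d := by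
          refine sum_le_sum_of_subset_of_nonneg (fun c hc => ?_) fun _ _ _ => le_max_right _ _
          exact mem_erase.2 ⟨fun h => hdB (h ▸ hc), mem_univ _⟩
  have h_strict : 2 * l * (q * n - n / 2) < 2 * l * ((topSupporters P B : ℝ) - n / 2) :=
    mul_lt_mul_of_pos_left (by linarith) (by positivity)
  nlinarith

/-- The rank of candidate `a` for voter `i` in the tight example: the candidates below `k` are
rotated cyclically, and candidate `k` is moved to the top by the voters `i ≥ s`. -/
def cyclicRank (k s i a : ℕ) : ℕ :=
  if i < s then (if a < k then (a + i) % k else a)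
  else if a < k then (a + i) % k + 1 else if a = k then 0 else a

lemma cyclicRank_lt {k s i a m : ℕ} (hk : 0 < k) (hkm : k < m) (ha : a < m) :
    cyclicRank k s i a < m := by
  have := Nat.mod_lt (a + i) hk
  unfold cyclicRank
  split_ifs <;> omega

lemma cyclicRank_injective {k : ℕ} (hk : 0 < k) (s i : ℕ) :
    Function.Injective (cyclicRank k s i) := by
  intro a b h
  have ha := Nat.mod_lt (a + i) hk
  have hb := Nat.mod_lt (b + i) hk
  have h_cancel : a < k → b < k → (a + i) % k = (b + i) % k → a = b := fun h1 h2 h3 =>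
    (Nat.ModEq.add_right_cancel' i h3).eq_of_lt_of_lt h1 h2
  unfold cyclicRank at h
  split_ifs at h <;> omega

/-- The profile with ranks `cyclicRank k s`. -/
def cyclicProfile {m k : ℕ} (hk : 0 < k) (hkm : k < m) (s n : ℕ) : Profile m n := fun i =>
  Equiv.ofBijective (fun a => ⟨cyclicRank k s i a, cyclicRank_lt hk hkm a.2⟩)
    (Finite.injective_iff_bijective.1 fun _ _ h =>
      Fin.ext (cyclicRank_injective hk s i (Fin.mk.inj h)))

lemma cyclicProfile_lt_iff {m k : ℕ} (hk : 0 < k) (hkm : k < m) (s n : ℕ) (i : Fin n)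
    (a b : Fin m) : cyclicProfile hk hkm s n i a < cyclicProfile hk hkm s n i b ↔
      cyclicRank k s i a < cyclicRank k s i b := Iff.rfl

lemma card_filter_rotation (k b y r : ℕ) :
    (univ.filter fun i : Fin (r * k) => (b + i) % k + y < k).card = r * (k - y) := by
  have h_per : Function.Periodic (fun u => u % k + y < k) k := fun u => by
    simp
  have h_per' : Function.Periodic (fun u => u % k + y < k) (r * k) := h_per.nat_mul r
  have h_shift : (univ.filter fun i : Fin (r * k) => (b + i) % k + y < k).card =
      ((Ico b (b + r * k)).filter fun u => u % k + y < k).card := by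
    refine card_bij (fun i _ => b + i) ?_ ?_ ?_
    · intro i hi
      have := i.2
      simp only [mem_filter, mem_univ, true_and, mem_Ico] at hi ⊢
      omega
    · intro i _ j _ h
      exact Fin.ext (by omega)
    · intro u hu
      simp only [mem_filter, mem_Ico] at hu
      refine ⟨⟨u - b, by omega⟩, ?_, by simp; omega⟩
      simp only [mem_filter, mem_univ, true_and]
      rw [Nat.add_sub_cancel' hu.1.1]
      exact hu.2
  have h_count : ∀ r : ℕ, Nat.count (fun u => u % k + y < k) (r * k) = r * (k - y) := by
    intro r
    induction r with
    | zero => simp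
    | succ r ih =>
      rw [Nat.succ_mul, Nat.count_add, ih, Nat.succ_mul]
      congr 1
      rw [Nat.count_eq_card_filter_range]
      have : ((range k).filter fun j => (r * k + j) % k + y < k) = range (k - y) := by
        ext j
        simp only [mem_filter, mem_range, Nat.mul_add_mod_self_right]
        constructor
        · rintro ⟨h1, h2⟩
          rw [Nat.mod_eq_of_lt h1] at h2
          omega
        · intro h
          have h1 : j < k := by omega
          rw [Nat.mod_eq_of_lt h1]
          omega
      rw [this, card_range]
  rw [h_shift, Nat.filter_Ico_card_eq_of_periodic _ _ _ h_per', h_count]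

lemma pairs_cyclicProfile_rotation {m k : ℕ} (hk : 0 < k) (hkm : k < m) (s r y : ℕ) (hy : 0 < y)
    (hyk : y < k) (b c : Fin m) (hb : (b : ℕ) < k) (hc : (c : ℕ) = (b + y) % k) :
    pairs (cyclicProfile hk hkm s (r * k)) b c = r * (k - y) := by
  rw [← card_filter_rotation k b y r, pairs]
  congr 1
  refine filter_congr fun i _ => ?_
  have hck : (c : ℕ) < k := hc ▸ Nat.mod_lt _ hk
  have hu := Nat.mod_lt (b + i : ℕ) hk
  have h_rot : ((c : ℕ) + i) % k = (((b : ℕ) + i) % k + y) % k := by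
    rw [hc, Nat.mod_add_mod, Nat.mod_add_mod]
    congr 1
    ring
  have h_iff : ((b : ℕ) + i) % k < ((c : ℕ) + i) % k ↔ ((b : ℕ) + i) % k + y < k := by
    rw [h_rot]
    generalize ((b : ℕ) + i) % k = u at hu
    by_cases h : u + y < k
    · rw [Nat.mod_eq_of_lt h]; omega
    · rw [Nat.mod_eq_sub_mod (by omega), Nat.mod_eq_of_lt (by omega)]; omega
  rw [cyclicProfile_lt_iff, ← h_iff]
  unfold cyclicRank
  simp only [hb, hck, if_true]
  split_ifs <;> omega

lemma not_majorityCriterion_clrWinners {l : ℕ} (hl : 0 < l) (hm : 2 * l < m) {q : ℝ}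
    (hq : q < (5 * (2 * l : ℝ) - 2) / (8 * (2 * l))) :
    ¬ MajorityCriterion m (2 * l) q (fun _ P => clrWinners P) := by
  intro h
  have hk : 0 < 2 * l := by omega
  have hl' : (1 : ℝ) ≤ l := by exact_mod_cast hl
  set s := 5 * (2 * l) - 2 with hs
  set P : Profile m (8 * (2 * l)) := cyclicProfile hk hm s (8 * (2 * l)) with hP
  set B : Finset (Fin m) := univ.filter fun a => (a : ℕ) < 2 * l with hB
  set c : Fin m := ⟨2 * l, hm⟩ with hc
  have h_early : (univ.filter fun i : Fin (8 * (2 * l)) => (i : ℕ) < s).card = s := by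
    rw [Fin.card_filter_val_lt]; omega
  have h_card : B.card = 2 * l := by
    rw [hB, Fin.card_filter_val_lt]; omega
  have h_top : s ≤ topSupporters P B := by
    rw [← h_early]
    refine card_le_card fun i hi => ?_
    simp only [mem_filter, mem_univ, true_and, hB] at hi ⊢
    intro a ha b hb
    have := Nat.mod_lt (a + i : ℕ) hk
    rw [hP, cyclicProfile_lt_iff]
    simp only [cyclicRank, hi, ha, hb, if_true, if_false]
    omega
  have h_scast : (s : ℝ) = 5 * (2 * l) - 2 := by
    rw [hs, Nat.cast_sub (by omega)]; push_cast; ring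
  -- Against the candidates of `B`, candidate `c` is preferred exactly by the voters `i ≥ s`.
  have h_pairs : ∀ a : Fin m, (a : ℕ) < 2 * l → (pairs P c a : ℝ) = 6 * l + 2 := by
    intro a ha
    have h1 : pairs P a c = s := by
      rw [← h_early, pairs]
      congr 1
      refine filter_congr fun i _ => ?_
      have := Nat.mod_lt (a + i : ℕ) hk
      rw [hP, cyclicProfile_lt_iff]
      simp only [cyclicRank, ha, hc, if_true, lt_irrefl, if_false]
      split_ifs <;> omega
    have h2 : (pairs P a c : ℝ) + pairs P c a = 8 * (2 * l) := by
      exact_mod_cast pairs_add_pairs P (fun h => by rw [h] at ha; simp [hc] at ha)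
    rw [h1, h_scast] at h2
    linarith
  have h_c : clrScore P c = 4 * (l * (l - 1)) := by
    have : clrScore P c = ∑ _a ∈ B, (2 * (l : ℝ) - 2) := by
      have hsub : B ⊆ univ.erase c := fun a ha => mem_erase.2
        ⟨fun h => by rw [h] at ha; simp [hB, hc] at ha, mem_univ _⟩
      rw [clrScore, ← sum_subset hsub]
      · refine sum_congr rfl fun a ha => ?_
        rw [h_pairs a (mem_filter.1 ha).2, max_eq_left] <;> push_cast <;> linarith
      · intro a ha haB
        have hac : 2 * l < (a : ℕ) := by
          have h1 : ¬ (a : ℕ) < 2 * l := fun h => haB (by simp [hB, h])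
          have h2 : (a : ℕ) ≠ 2 * l := fun h => ne_of_mem_erase ha (Fin.ext h)
          omega
        have : pairs P c a = 8 * (2 * l) := by
          have h_all : ∀ i, P i c < P i a := fun i => by
            rw [hP, cyclicProfile_lt_iff]
            simp only [cyclicRank, hc, lt_irrefl, if_false]
            split_ifs <;> omega
          simp [pairs, h_all]
        rw [this]
        refine max_eq_right ?_
        push_cast
        linarith
    rw [this, sum_const, h_card, nsmul_eq_mul]
    push_cast
    ring
  have h_min : ∀ a, clrScore P c ≤ clrScore P a := by
    intro a
    rw [h_c]
    rcases lt_trichotomy (a : ℕ) (2 * l) with ha | ha | ha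
    · let g : ℕ → Fin m := fun y => ⟨(a + y) % (2 * l), (Nat.mod_lt _ hk).trans hm⟩
      have hg : Set.InjOn g (Ico 1 (2 * l)) := by
        intro y hy z hz h
        have hy' := mem_Ico.1 hy
        have hz' := mem_Ico.1 hz
        exact Nat.ModEq.eq_of_lt_of_lt
          (Nat.ModEq.add_left_cancel' (a : ℕ) (Fin.mk.inj h)) hy'.2 hz'.2
      have hga : ∀ y ∈ Ico 1 (2 * l), g y ≠ a := by
        intro y hy h
        have hy' := mem_Ico.1 hy
        have h1 : ((a : ℕ) + y) % (2 * l) = a := congrArg Fin.val h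
        have h2 : (a : ℕ) + y ≡ a + 0 [MOD 2 * l] := by
          rw [Nat.ModEq, h1, add_zero, Nat.mod_eq_of_lt ha]
        have := (Nat.ModEq.add_left_cancel' (a : ℕ) h2).eq_of_lt_of_lt hy'.2 hk
        omega
      calc 4 * ((l : ℝ) * (l - 1))
          = ∑ y ∈ range (2 * l), 4 * max (2 * (y : ℝ) - 2 * l) 0 := by
            rw [← mul_sum, sum_range_max_two_mul_sub]
        _ = ∑ y ∈ Ico 1 (2 * l), 4 * max (2 * (y : ℝ) - 2 * l) 0 := by
            symm
            refine sum_subset (fun y hy => mem_range.2 (mem_Ico.1 hy).2) fun y hy hy' => ?_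
            have : y = 0 := by
              simp only [mem_range, mem_Ico] at hy hy'
              omega
            subst this
            rw [max_eq_right] <;> simp
        _ = ∑ y ∈ Ico 1 (2 * l), max (((8 * (2 * l) : ℕ) : ℝ) / 2 - pairs P a (g y)) 0 := by
            refine sum_congr rfl fun y hy => ?_
            have hy' := mem_Ico.1 hy
            rw [hP, pairs_cyclicProfile_rotation hk hm s 8 y hy'.1 hy'.2 a (g y) ha rfl,
              mul_max_of_nonneg _ _ (by norm_num : (0 : ℝ) ≤ 4)]
            push_cast [Nat.cast_sub hy'.2.le]
            congr 1 <;> ring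
        _ = ∑ d ∈ (Ico 1 (2 * l)).image g,
              max (((8 * (2 * l) : ℕ) : ℝ) / 2 - pairs P a d) 0 :=
            (sum_image (f := fun d => max (((8 * (2 * l) : ℕ) : ℝ) / 2 - pairs P a d) 0) hg).symm
        _ ≤ clrScore P a := by
            refine sum_le_sum_of_subset_of_nonneg (fun d hd => ?_) fun _ _ _ => le_max_right _ _
            obtain ⟨y, hy, rfl⟩ := mem_image.1 hd
            exact mem_erase.2 ⟨hga y hy, mem_univ _⟩
    · rw [show a = c from Fin.ext ha, h_c]
    · calc 4 * ((l : ℝ) * (l - 1)) ≤ ∑ _b ∈ B, 8 * (l : ℝ) := by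
            rw [sum_const, h_card, nsmul_eq_mul]
            push_cast
            nlinarith
        _ ≤ ∑ b ∈ B, max (((8 * (2 * l) : ℕ) : ℝ) / 2 - pairs P a b) 0 := by
            refine sum_le_sum fun b hb => le_max_of_le_left ?_
            have hb' : (b : ℕ) < 2 * l := (mem_filter.1 hb).2
            have : pairs P a b = 0 := by
              rw [pairs, card_eq_zero, filter_eq_empty_iff]
              intro i _
              have := Nat.mod_lt (b + i : ℕ) hk
              rw [hP, cyclicProfile_lt_iff]
              simp only [cyclicRank, hb', if_true]
              split_ifs <;> omega
            rw [this]
            push_cast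
            linarith
        _ ≤ clrScore P a := by
            refine sum_le_sum_of_subset_of_nonneg (fun b hb => ?_) fun _ _ _ => le_max_right _ _
            have hb' : (b : ℕ) < 2 * l := (mem_filter.1 hb).2
            exact mem_erase.2 ⟨fun h => by rw [h] at hb'; omega, mem_univ _⟩
  have hcB : c ∈ B := by
    refine h _ (by omega) P B h_card ?_ (mem_filter.2 ⟨mem_univ _, h_min⟩)
    rw [lt_div_iff₀ (by positivity)] at hq
    have h_top' : (s : ℝ) ≤ topSupporters P B := by exact_mod_cast h_top
    push_cast
    linarith
  simp [hB, hc] at hcB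

/-- For every even integer `k ≥ 2`, every `m > k` and every real `q` with
`0 < q < 1`, the Condorcet least-reversal rule satisfies the `(q,k,m)`-majority
criterion iff `q ≥ (5k−2)/(8k)`. -/
theorem clr_qkm_majority_even (m k : ℕ) (hk : 2 ≤ k) (hke : k % 2 = 0)
    (hmk : k < m) (q : ℝ) (hq0 : 0 < q) (hq1 : q < 1) :
    MajorityCriterion m k q (fun n P => clrWinners P) ↔
      (5 * (k : ℝ) - 2) / (8 * (k : ℝ)) ≤ q := by
  obtain ⟨l, rfl⟩ : ∃ l, k = 2 * l := ⟨k / 2, by omega⟩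
  have hl : 0 < l := by omega
  push_cast
  refine ⟨fun h => ?_, majorityCriterion_clrWinners hl⟩
  by_contra! hq
  exact not_majorityCriterion_clrWinners hl hmk hq h

end Voting
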